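/- arXiv:2411.12860 — 2 statements merged into one kernel-verified Lean document; each statement's English description precedes it below -/
import Mathlib

section
/- If |H| ≤ |C|, then Serial Dictatorship with Indifference applied to the unanimous rankings is non-obviously manipulable: no child has a worst-case manipulation or a best-case manipulation. -/
open scoped Classical

noncomputable section

variable {C H : Type*}

/-- Relations on `Option α`: rankings over homes together with `∅` (= `none`). -/
abbrev OptRel (α : Type*) := Option α → Option α → Prop

/-- `μ` is a (partial, one-to-one) matching: no home is assigned to two distinct children. -/
def IsMatching (μ : C → Option H) : Prop :=
  ∀ c c' h, μ c = some h → μ c' = some h → c = c'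

/-- `h` is unanimously acceptable for `c`: `h ≻_c ∅` and `h >_c ∅`. -/
def UnanAcc (pref eval : C → OptRel H) (c : C) (h : H) : Prop :=
  pref c (some h) none ∧ eval c (some h) none

/-- The unanimous improvers of `c` over `x`: homes preferred to `x` in both rankings. -/
def Improvers (pref eval : C → OptRel H) (c : C) (x : Option H) : Set H :=
  {h' | pref c (some h') x ∧ eval c (some h') x}

/-- `H*(c)`: unanimously acceptable homes with no unanimous improvement. -/
def Hstar (pref eval : C → OptRel H) (c : C) : Set H :=
  {h | UnanAcc pref eval c h ∧ Improvers pref eval c (some h) = ∅}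

/-- `H^-(c)`: unanimously acceptable homes not in `H*(c)`. -/
def Hminus (pref eval : C → OptRel H) (c : C) : Set H :=
  {h | UnanAcc pref eval c h ∧ h ∉ Hstar pref eval c}

/-- A matching is acceptable if every matched child gets a unanimously acceptable home. -/
def Acceptable (pref eval : C → OptRel H) (μ : C → Option H) : Prop :=
  ∀ c h, μ c = some h → UnanAcc pref eval c h

/-- `I*(μ)`: children matched to a home in `H*(c)`. -/
def Istar (pref eval : C → OptRel H) (μ : C → Option H) : Set C :=
  {c | ∃ h, μ c = some h ∧ h ∈ Hstar pref eval c}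

/-- `κ(μ)`: children matched to a unanimously acceptable home. -/
def kappaSet (pref eval : C → OptRel H) (μ : C → Option H) : Set C :=
  {c | ∃ h, μ c = some h ∧ (h ∈ Hstar pref eval c ∨ h ∈ Hminus pref eval c)}

/-- `μ ▷_UD μ'`: `μ` is unanimously dominated by `μ'`. -/
def UDom (pref eval : C → OptRel H) (μ μ' : C → Option H) : Prop :=
  (Istar pref eval μ ⊂ Istar pref eval μ' ∧ kappaSet pref eval μ ⊆ kappaSet pref eval μ') ∨
  (Istar pref eval μ ⊆ Istar pref eval μ' ∧ kappaSet pref eval μ ⊂ kappaSet pref eval μ')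

/-- An acceptable matching is unanimous if no acceptable matching unanimously dominates it. -/
def Unanimous (pref eval : C → OptRel H) (μ : C → Option H) : Prop :=
  IsMatching μ ∧ Acceptable pref eval μ ∧
    ∀ μ', IsMatching μ' → Acceptable pref eval μ' → ¬ UDom pref eval μ μ'

/-- `μ` is ≻-Pareto dominated by `μ'` (for strict rankings). -/
def ParetoDom (pref : C → OptRel H) (μ μ' : C → Option H) : Prop :=
  (∀ c, μ' c = μ c ∨ pref c (μ' c) (μ c)) ∧ ∃ c, pref c (μ' c) (μ c)

/-- `μ` is ≻-efficient: no matching ≻-Pareto dominates it. -/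
def EfficientM (pref : C → OptRel H) (μ : C → Option H) : Prop :=
  ¬ ∃ μ', IsMatching μ' ∧ ParetoDom pref μ μ'

/-- The level of `x` in the unanimous ranking `>_{I(c)}`: homes in `H*(c)` at level 3,
homes in `H^-(c)` at level 2, `∅` at level 1, all other homes at level 0.
`x >_{I(c)} y` iff `urank x > urank y`, and `x ∼_{I(c)} y` iff ranks are equal. -/
def urank (pref eval : C → OptRel H) (c : C) : Option H → ℕ
  | none => 1
  | some h =>
      if h ∈ Hstar pref eval c then 3 else if h ∈ Hminus pref eval c then 2 else 0

/-- The weak unanimous ranking: `x ≿_{I(c)} y`. -/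
def uweak (pref eval : C → OptRel H) (c : C) (x y : Option H) : Prop :=
  urank pref eval c y ≤ urank pref eval c x

/-- The strict part of a weak ranking `w`. -/
def SPref (w : OptRel H) (x y : Option H) : Prop := w x y ∧ ¬ w y x

/-- Individual rationality: every matched child strictly prefers her home to `∅`. -/
def IndivRat (w : C → OptRel H) (μ : C → Option H) : Prop :=
  ∀ c h, μ c = some h → SPref (w c) (some h) none

/-- One round of Serial Dictatorship with Indifference: dictator `c` refines the
current set to her strictly-acceptable best elements, unless that set is empty. -/
def sdiStep (w : C → OptRel H) (Ucur : Set (C → Option H)) (c : C) : Set (C → Option H) :=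
  let best := {μ ∈ Ucur | SPref (w c) (μ c) none ∧ ∀ μ' ∈ Ucur, w c (μ c) (μ' c)}
  if best = ∅ then Ucur else best

/-- The initial set for SDI: individually rational matchings. -/
def sdiInit (w : C → OptRel H) : Set (C → Option H) :=
  {μ | IsMatching μ ∧ IndivRat w μ}

/-- The final set of SDI given the dictator order `order`; SDI outputs any element of it. -/
def sdiFinal (w : C → OptRel H) (order : List C) : Set (C → Option H) :=
  order.foldl (sdiStep w) (sdiInit w)

/-- `μ` is improvable: some matching weakly shrinks every child's set of unanimous
improvers and matches some child to one of her current unanimous improvers. -/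
def Improvable (pref eval : C → OptRel H) (μ : C → Option H) : Prop :=
  ∃ μ', IsMatching μ' ∧
    (∀ c, Improvers pref eval c (μ' c) ⊆ Improvers pref eval c (μ c)) ∧
    ∃ c h, μ' c = some h ∧ h ∈ Improvers pref eval c (μ c)

/-- The extended unanimity relation `T^u_c`. -/
def Tu (pref eval : C → OptRel H) (c : C) : Option H → Option H → Prop
  | some h, some h' =>
      (h ∈ Hstar pref eval c ∧ h' ∉ Hstar pref eval c) ∨
      (h ∈ Hminus pref eval c ∧ h' ∉ Hstar pref eval c ∪ Hminus pref eval c) ∨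
      (((h ∈ Hstar pref eval c ∧ h' ∈ Hstar pref eval c) ∨
        (h ∈ Hminus pref eval c ∧ h' ∈ Hminus pref eval c) ∨
        (h ∉ Hstar pref eval c ∪ Hminus pref eval c ∧
         h' ∉ Hstar pref eval c ∪ Hminus pref eval c)) ∧
        pref c (some h) (some h'))
  | some h, none => UnanAcc pref eval c h
  | none, some h => ¬ UnanAcc pref eval c h
  | none, none => False

/-- The outcome Random Serial Assignment (ignoring feasibility constraints) gives a child
reporting `r`, under availability function `a`: her `r`-best available acceptable home,
or `∅` if there is none. -/
def IsRSAOutcome (a : H → Bool) (r : OptRel H) (x : Option H) : Prop :=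
  (x = none ∧ ∀ h, a h = true → ¬ r (some h) none) ∨
  (∃ h, x = some h ∧ a h = true ∧ r (some h) none ∧
    ∀ h', a h' = true → r (some h') none → h' = h ∨ r (some h) (some h'))

/-- `x` is a `p`-worst element of `S`. -/
def IsWorst (p : OptRel H) (S : Set (Option H)) (x : Option H) : Prop :=
  x ∈ S ∧ ∀ y ∈ S, y = x ∨ p y x

/-- `x` is a `p`-best element of `S`. -/
def IsBest (p : OptRel H) (S : Set (Option H)) (x : Option H) : Prop :=
  x ∈ S ∧ ∀ y ∈ S, y = x ∨ p x y


/-- The set of assignments to child `c` consistent with her pair `(p, e)` under SDI applied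
to the unanimous rankings: outcomes for some dictator order covering all children, some
selection from the final set, and some strict profile of the other children. -/
def SDIConsistentOut {C H : Type*} (c : C) (p e : OptRel H) : Set (Option H) :=
  {x | ∃ (pref eval : C → OptRel H) (order : List C) (μ : C → Option H),
        (∀ c', IsStrictTotalOrder (Option H) (pref c')) ∧
        (∀ c', IsStrictTotalOrder (Option H) (eval c')) ∧
        pref c = p ∧ eval c = e ∧ (∀ c'', c'' ∈ order) ∧
        μ ∈ sdiFinal (uweak pref eval) order ∧ μ c = x}

/-- The order obtained from `p` by moving `y` to the top and `∅` directly below it. -/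
def promote (p : OptRel H) (y : Option H) : OptRel H := fun a b =>
  let k : Option H → ℕ := fun z => if z = y then 0 else if z = none then 1 else 2
  k a < k b ∨ (k a = k b ∧ p a b)

lemma promote_isStrictTotalOrder (p : OptRel H) (hp : IsStrictTotalOrder (Option H) p)
    (y : Option H) : IsStrictTotalOrder (Option H) (promote p y) where
  irrefl a h := by
    rcases h with h | h
    · exact lt_irrefl _ h
    · exact hp.irrefl _ h.2
  trans a b d hab hbd := by
    rcases hab with h | ⟨h, h'⟩ <;> rcases hbd with g | ⟨g, g'⟩
    · exact Or.inl (h.trans g)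
    · exact Or.inl (h.trans_eq g)
    · exact Or.inl (h.trans_lt g)
    · exact Or.inr ⟨h.trans g, hp.trans _ _ _ h' g'⟩
  trichotomous a b hab hba := by
    simp only [promote, not_or, not_and, not_lt] at hab hba
    have hk := le_antisymm hba.1 hab.1
    exact hp.trichotomous a b (hab.2 hk) (hba.2 hk.symm)

lemma promote_some_none_iff {p : OptRel H} (hp : IsStrictTotalOrder (Option H) p)
    (y : Option H) (h : H) : promote p y (some h) none ↔ some h = y := by
  unfold promote
  have := hp.irrefl none
  by_cases h1 : some h = y
  · subst h1; simp
  · by_cases h2 : none = y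
    · subst h2; simp
    · simp [h1, h2]

lemma uweak_iff (pref eval : C → OptRel H) (c : C) (x y : Option H) :
    uweak pref eval c x y ↔ urank pref eval c y ≤ urank pref eval c x := Iff.rfl

lemma spref_uweak_none_iff (pref eval : C → OptRel H) (c : C) (x : Option H) :
    SPref (uweak pref eval c) x none ↔ 1 < urank pref eval c x := by
  simp only [SPref, uweak_iff, urank]
  omega

lemma one_lt_urank_some_iff (pref eval : C → OptRel H) (c : C) (h : H) :
    1 < urank pref eval c (some h) ↔ UnanAcc pref eval c h := by
  simp only [urank]
  by_cases h1 : h ∈ Hstar pref eval c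
  · simp [h1, h1.1]
  · by_cases h2 : h ∈ Hminus pref eval c
    · simp [h1, h2, h2.1]
    · have : ¬ UnanAcc pref eval c h := fun h3 => h2 ⟨h3, h1⟩
      simp [h1, h2, this]

lemma urank_le_three (pref eval : C → OptRel H) (c : C) (x : Option H) :
    urank pref eval c x ≤ 3 := by
  cases x with
  | none => simp [urank]
  | some h => simp only [urank]; split_ifs <;> omega

lemma IndivRat.unanAcc {pref eval : C → OptRel H} {μ : C → Option H}
    (hμ : IndivRat (uweak pref eval) μ) {c : C} {h : H} (hc : μ c = some h) :
    UnanAcc pref eval c h :=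
  (one_lt_urank_some_iff pref eval c h).1 ((spref_uweak_none_iff _ _ _ _).1 (hμ c h hc))

lemma IndivRat.one_le_urank {pref eval : C → OptRel H} {μ : C → Option H}
    (hμ : IndivRat (uweak pref eval) μ) (c : C) : 1 ≤ urank pref eval c (μ c) := by
  cases hc : μ c with
  | none => simp [urank]
  | some h => exact ((one_lt_urank_some_iff pref eval c h).2 (hμ.unanAcc hc)).le

lemma indivRat_of_acceptable {pref eval : C → OptRel H} {μ : C → Option H}
    (hμ : Acceptable pref eval μ) : IndivRat (uweak pref eval) μ := fun c h hc =>
  (spref_uweak_none_iff _ _ _ _).2 ((one_lt_urank_some_iff pref eval c h).2 (hμ c h hc))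

lemma sdiStep_subset (w : C → OptRel H) (U : Set (C → Option H)) (c : C) :
    sdiStep w U c ⊆ U := by
  unfold sdiStep
  intro μ hμ
  dsimp only at hμ
  split_ifs at hμ with h
  · exact hμ
  · exact hμ.1

lemma foldl_sdiStep_subset (w : C → OptRel H) (l : List C) (U : Set (C → Option H)) :
    l.foldl (sdiStep w) U ⊆ U := by
  induction l generalizing U with
  | nil => exact subset_rfl
  | cons a l ih => exact (ih _).trans (sdiStep_subset w U a)

lemma sdiFinal_subset (w : C → OptRel H) (l : List C) : sdiFinal w l ⊆ sdiInit w :=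
  foldl_sdiStep_subset w l _

/-- If some matching in `U` attains the maximal rank of `c` and is acceptable to `c`, the round
of `c` keeps exactly the matchings attaining that rank. -/
lemma mem_sdiStep_iff {pref eval : C → OptRel H} {U : Set (C → Option H)} {c : C}
    {μ₀ : C → Option H} (h₀ : μ₀ ∈ U) (hlt : 1 < urank pref eval c (μ₀ c))
    (hmax : ∀ μ ∈ U, urank pref eval c (μ c) ≤ urank pref eval c (μ₀ c)) (μ : C → Option H) :
    μ ∈ sdiStep (uweak pref eval) U c ↔
      μ ∈ U ∧ urank pref eval c (μ₀ c) ≤ urank pref eval c (μ c) := by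
  unfold sdiStep
  dsimp only
  have hne : {μ ∈ U | SPref (uweak pref eval c) (μ c) none ∧
      ∀ μ' ∈ U, uweak pref eval c (μ c) (μ' c)} ≠ ∅ :=
    Set.Nonempty.ne_empty ⟨μ₀, h₀, (spref_uweak_none_iff _ _ _ _).2 hlt, hmax⟩
  rw [if_neg hne]
  constructor
  · rintro ⟨h, -, h'⟩
    exact ⟨h, h' _ h₀⟩
  · rintro ⟨h, h'⟩
    exact ⟨h, (spref_uweak_none_iff _ _ _ _).2 (hlt.trans_le h'),
      fun μ' hμ' => (hmax μ' hμ').trans h'⟩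

/-- If no matching in `U` is acceptable to `c` beyond `∅`, the round of `c` changes nothing. -/
lemma sdiStep_eq_self {pref eval : C → OptRel H} {U : Set (C → Option H)} {c : C}
    (h : ∀ μ ∈ U, urank pref eval c (μ c) ≤ 1) : sdiStep (uweak pref eval) U c = U := by
  unfold sdiStep
  dsimp only
  rw [if_pos]
  refine Set.eq_empty_of_forall_notMem ?_
  rintro μ ⟨hμ, hs, -⟩
  exact absurd ((spref_uweak_none_iff _ _ _ _).1 hs) (h μ hμ).not_gt

lemma sdiStep_of_forall_le {pref eval : C → OptRel H} {U : Set (C → Option H)} {c : C}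
    {μ₀ : C → Option H} (h₀ : μ₀ ∈ U) (hU : ∀ μ ∈ U, 1 ≤ urank pref eval c (μ c))
    (hmax : ∀ μ ∈ U, urank pref eval c (μ c) ≤ urank pref eval c (μ₀ c)) :
    μ₀ ∈ sdiStep (uweak pref eval) U c ∧ ∀ μ ∈ sdiStep (uweak pref eval) U c,
      urank pref eval c (μ₀ c) ≤ urank pref eval c (μ c) := by
  rcases lt_or_ge 1 (urank pref eval c (μ₀ c)) with hlt | hle
  · simp only [mem_sdiStep_iff h₀ hlt hmax]
    exact ⟨⟨h₀, le_rfl⟩, fun μ hμ => hμ.2⟩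
  · rw [sdiStep_eq_self fun μ hμ => (hmax μ hμ).trans hle]
    exact ⟨h₀, fun μ hμ => hle.trans (hU μ hμ)⟩

lemma foldl_sdiStep_of_forall_le {pref eval : C → OptRel H} {μ₀ : C → Option H} (l : List C)
    (U : Set (C → Option H)) (h₀ : μ₀ ∈ U) (hU : U ⊆ sdiInit (uweak pref eval))
    (hmax : ∀ c ∈ l, ∀ μ ∈ U, urank pref eval c (μ c) ≤ urank pref eval c (μ₀ c)) :
    μ₀ ∈ l.foldl (sdiStep (uweak pref eval)) U ∧
      ∀ μ ∈ l.foldl (sdiStep (uweak pref eval)) U, ∀ c ∈ l,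
        urank pref eval c (μ₀ c) ≤ urank pref eval c (μ c) := by
  induction l generalizing U with
  | nil => exact ⟨h₀, fun _ _ _ hc => absurd hc List.not_mem_nil⟩
  | cons a l ih =>
    have hsub := sdiStep_subset (uweak pref eval) U a
    have hstep := sdiStep_of_forall_le h₀ (fun μ hμ => (hU hμ).2.one_le_urank a)
      (hmax a List.mem_cons_self)
    have hrec := ih _ hstep.1 (hsub.trans hU)
      fun c hc μ hμ => hmax c (List.mem_cons_of_mem _ hc) μ (hsub hμ)
    refine ⟨hrec.1, fun μ hμ c hc => ?_⟩
    rcases List.mem_cons.1 hc with rfl | hc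
    · exact hstep.2 μ (foldl_sdiStep_subset _ l _ hμ)
    · exact hrec.2 μ hμ c hc

/-- A matching that is acceptable to `c` and assigns every home acceptable to `c` is consistent
with the pair of `c`. -/
lemma mem_SDIConsistentOut_of_matching [Fintype C] {c : C} {p e : OptRel H}
    (hp : IsStrictTotalOrder (Option H) p) (he : IsStrictTotalOrder (Option H) e)
    {μ₀ : C → Option H} (hμ₀ : IsMatching μ₀)
    (hacc : ∀ h, μ₀ c = some h → p (some h) none ∧ e (some h) none)
    (hcover : ∀ h, p (some h) none → e (some h) none → ∃ c', μ₀ c' = some h) :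
    μ₀ c ∈ SDIConsistentOut c p e := by
  set pref : C → OptRel H := fun c' => if c' = c then p else promote p (μ₀ c') with hpref
  set eval : C → OptRel H := fun c' => if c' = c then e else promote p (μ₀ c') with heval
  have hpc : pref c = p := if_pos rfl
  have hec : eval c = e := if_pos rfl
  have hp' : ∀ c' ≠ c, pref c' = promote p (μ₀ c') := fun c' h => if_neg h
  have he' : ∀ c' ≠ c, eval c' = promote p (μ₀ c') := fun c' h => if_neg h
  have haccIff : ∀ c' ≠ c, ∀ h, UnanAcc pref eval c' h ↔ some h = μ₀ c' := by
    intro c' hc' h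
    simp only [UnanAcc, hp' c' hc', he' c' hc', promote_some_none_iff hp, and_self]
  have hIR : Acceptable pref eval μ₀ := by
    intro c' h hh
    by_cases hc' : c' = c
    · subst hc'
      simpa only [UnanAcc, hpc, hec] using hacc h hh
    · exact (haccIff c' hc' h).2 hh.symm
  have hinit : μ₀ ∈ sdiInit (uweak pref eval) := ⟨hμ₀, indivRat_of_acceptable hIR⟩
  have htop : ∀ c' ≠ c, ∀ μ ∈ sdiInit (uweak pref eval),
      urank pref eval c' (μ c') ≤ urank pref eval c' (μ₀ c') := by
    intro c' hc' μ hμ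
    cases hh : μ c' with
    | none => exact hinit.2.one_le_urank c'
    | some h => rw [(haccIff c' hc' h).1 (hμ.2.unanAcc hh)]
  set l := (Finset.univ.erase c).toList with hl
  have hmem : ∀ c', c' ∈ l ↔ c' ≠ c := fun c' => by simp [hl]
  have hfold := foldl_sdiStep_of_forall_le l _ hinit subset_rfl
    fun c' hc' => htop c' ((hmem c').1 hc')
  have hsub := foldl_sdiStep_subset (uweak pref eval) l (sdiInit (uweak pref eval))
  refine ⟨pref, eval, l ++ [c], μ₀, ?_, ?_, hpc, hec, ?_, ?_, rfl⟩
  · intro c'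
    simp only [hpref]
    split_ifs
    · exact hp
    · exact promote_isStrictTotalOrder p hp _
  · intro c'
    simp only [heval]
    split_ifs
    · exact he
    · exact promote_isStrictTotalOrder p hp _
  · intro c'
    by_cases hc' : c' = c
    · simp [hc']
    · exact List.mem_append_left _ ((hmem c').2 hc')
  · rw [sdiFinal, List.foldl_append]
    refine (sdiStep_of_forall_le hfold.1 (fun μ hμ => (hsub hμ).2.one_le_urank c) ?_).1
    intro μ hμ
    cases hh : μ c with
    | none => exact hinit.2.one_le_urank c
    | some h =>
      have hA : UnanAcc pref eval c h := (hsub hμ).2.unanAcc hh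
      obtain ⟨c', hc'⟩ := hcover h (hpc ▸ hA.1) (hec ▸ hA.2)
      by_cases hcc : c' = c
      · rw [← hcc, hc']
      · have hle := hfold.2 μ hμ c' ((hmem c').2 hcc)
        rw [hc'] at hle
        have hlt := ((one_lt_urank_some_iff pref eval c' h).2
          ((haccIff c' hcc h).2 hc'.symm)).trans_le hle
        cases hh' : μ c' with
        | none => simp [hh', urank] at hlt
        | some h' =>
          have heq := (haccIff c' hcc h').1 ((hsub hμ).2.unanAcc hh')
          rw [hc', Option.some.injEq] at heq
          subst heq
          exact absurd ((hsub hμ).1 _ _ _ hh' hh) hcc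

lemma isMatching_partialInv {g : H → C} (hg : g.Injective) :
    IsMatching (Function.partialInv g) := fun c c' h h1 h2 =>
  ((hg.isPartialInv h c).1 h1).symm.trans
    ((hg.isPartialInv h c').1 h2)

lemma exists_injective_apply_eq [Fintype C] [Fintype H]
    (hcard : Fintype.card H ≤ Fintype.card C) (x : H) (c : C) :
    ∃ g : H → C, g.Injective ∧ g x = c := by
  obtain ⟨g⟩ := Function.Embedding.nonempty_of_card_le hcard
  exact ⟨Equiv.swap (g x) c ∘ g, (Equiv.injective _).comp g.injective, by simp⟩

lemma some_mem_SDIConsistentOut [Fintype C] [Fintype H]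
    (hcard : Fintype.card H ≤ Fintype.card C) {c : C} {p e : OptRel H}
    (hp : IsStrictTotalOrder (Option H) p) (he : IsStrictTotalOrder (Option H) e) {x : H}
    (hpx : p (some x) none) (hex : e (some x) none) :
    some x ∈ SDIConsistentOut c p e := by
  obtain ⟨g, hg, rfl⟩ := exists_injective_apply_eq hcard x c
  rw [← Function.partialInv_left hg x]
  refine mem_SDIConsistentOut_of_matching hp he (isMatching_partialInv hg) ?_
    fun h _ _ => ⟨g h, Function.partialInv_left hg h⟩
  intro h hh
  rw [Function.partialInv_left hg, Option.some.injEq] at hh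
  exact hh ▸ ⟨hpx, hex⟩

lemma none_mem_SDIConsistentOut_of_not_acceptable [Fintype C] [Fintype H]
    (hcard : Fintype.card H ≤ Fintype.card C) {c : C} {p e : OptRel H}
    (hp : IsStrictTotalOrder (Option H) p) (he : IsStrictTotalOrder (Option H) e) {x : H}
    (hx : ¬ (p (some x) none ∧ e (some x) none)) :
    none ∈ SDIConsistentOut c p e := by
  obtain ⟨g, hg, hgx⟩ := exists_injective_apply_eq hcard x c
  have hself : Function.update (Function.partialInv g) c none c = none := by simp
  have h := mem_SDIConsistentOut_of_matching (c := c) hp he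
    (μ₀ := Function.update (Function.partialInv g) c none) ?_ ?_ ?_
  · rwa [hself] at h
  · intro a b h ha hb
    have hac : a ≠ c := by rintro rfl; simp at ha
    have hbc : b ≠ c := by rintro rfl; simp at hb
    rw [Function.update_of_ne hac] at ha
    rw [Function.update_of_ne hbc] at hb
    exact isMatching_partialInv hg a b h ha hb
  · intro h hh
    simp at hh
  · intro h h1 h2
    have hne : g h ≠ c := by
      rw [← hgx]
      exact fun heq => hx (hg heq ▸ ⟨h1, h2⟩)
    exact ⟨g h, by rw [Function.update_of_ne hne, Function.partialInv_left hg]⟩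

lemma none_mem_SDIConsistentOut_of_card_lt [Fintype C] [Fintype H]
    (hcard : Fintype.card H < Fintype.card C) {c : C} {p e : OptRel H}
    (hp : IsStrictTotalOrder (Option H) p) (he : IsStrictTotalOrder (Option H) e) :
    none ∈ SDIConsistentOut c p e := by
  obtain ⟨g, hg⟩ : ∃ g : H → {c' : C // c' ≠ c}, g.Injective := by
    obtain ⟨g⟩ := Function.Embedding.nonempty_of_card_le
      (α := H) (β := {c' : C // c' ≠ c}) (by
        rw [Fintype.card_subtype_compl, Fintype.card_subtype_eq]; omega)
    exact ⟨g, g.injective⟩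
  have hg' : Function.Injective (fun h => (g h : C)) := Subtype.val_injective.comp hg
  have hc : Function.partialInv (fun h => (g h : C)) c = none := by
    rw [Option.eq_none_iff_forall_ne_some]
    intro h hh
    exact (g h).2 ((hg'.isPartialInv h c).1 hh)
  rw [← hc]
  refine mem_SDIConsistentOut_of_matching hp he (isMatching_partialInv hg') ?_
    fun h _ _ => ⟨g h, Function.partialInv_left hg' h⟩
  intro h hh
  rw [hc] at hh
  cases hh

lemma acceptable_of_some_mem_SDIConsistentOut {c : C} {p e : OptRel H} {x : H}
    (hx : some x ∈ SDIConsistentOut c p e) : p (some x) none ∧ e (some x) none := by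
  obtain ⟨pref, eval, order, μ, -, -, rfl, rfl, -, hμ, hc⟩ := hx
  exact (sdiFinal_subset _ _ hμ).2.unanAcc hc

/-- `U` is closed under assigning to an unmatched child `c` any home that is left over. -/
def ClosedUnderFilling (c : C) (U : Set (C → Option H)) : Prop :=
  ∀ μ ∈ U, μ c = none → ∀ h, (∀ c', μ c' ≠ some h) → Function.update μ c (some h) ∈ U

lemma ClosedUnderFilling.sdiStep {w : C → OptRel H} {c a : C} (ha : a ≠ c)
    {U : Set (C → Option H)} (hU : ClosedUnderFilling c U) :
    ClosedUnderFilling c (sdiStep w U a) := by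
  intro μ hμ hc h hh
  have hmem := hU μ (sdiStep_subset _ _ _ hμ) hc h hh
  unfold _root_.sdiStep at hμ ⊢
  dsimp only at hμ ⊢
  split_ifs at hμ ⊢ with h1
  · exact hmem
  · refine ⟨hmem, ?_⟩
    rw [Function.update_of_ne ha]
    exact hμ.2

lemma ne_none_of_mem_sdiStep {pref eval : C → OptRel H} {c : C} {U : Set (C → Option H)}
    (hex : ∃ μ ∈ U, 1 < urank pref eval c (μ c)) {μ : C → Option H}
    (hμ : μ ∈ sdiStep (uweak pref eval) U c) : μ c ≠ none := by
  obtain ⟨μ₁, h₁, hlt⟩ := hex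
  have hfin : ((fun μ : C → Option H => urank pref eval c (μ c)) '' U).Finite :=
    (Set.finite_Iic 3).subset (by
      rintro _ ⟨μ, -, rfl⟩
      exact urank_le_three pref eval c _)
  obtain ⟨_, ⟨μ₀, h₀, rfl⟩, hmax'⟩ := Set.exists_max_image _ id hfin ⟨_, μ₁, h₁, rfl⟩
  have hmax : ∀ μ ∈ U, urank pref eval c (μ c) ≤ urank pref eval c (μ₀ c) :=
    fun μ hμ => hmax' _ ⟨μ, hμ, rfl⟩
  have hlt₀ := hlt.trans_le (hmax μ₁ h₁)
  have h := hlt₀.trans_le ((mem_sdiStep_iff h₀ hlt₀ hmax μ).1 hμ).2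
  intro hc
  simp [hc, urank] at h

lemma sdiStep_nonempty {pref eval : C → OptRel H} (c : C) {U : Set (C → Option H)}
    (hU : U.Nonempty) : (sdiStep (uweak pref eval) U c).Nonempty := by
  unfold sdiStep
  dsimp only
  split_ifs with h
  · exact hU
  · exact Set.nonempty_iff_ne_empty.2 h

lemma ne_none_of_mem_foldl_sdiStep [Fintype C] [Fintype H]
    (hcard : Fintype.card H = Fintype.card C) {pref eval : C → OptRel H} {c : C}
    (hacc : ∀ h, UnanAcc pref eval c h) (l : List C) (hl : c ∈ l) (U : Set (C → Option H))
    (hne : U.Nonempty) (hU : U ⊆ sdiInit (uweak pref eval)) (hclosed : ClosedUnderFilling c U)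
    {μ : C → Option H} (hμ : μ ∈ l.foldl (sdiStep (uweak pref eval)) U) : μ c ≠ none := by
  induction l generalizing U with
  | nil => exact absurd hl List.not_mem_nil
  | cons a l ih =>
    by_cases ha : a = c
    · subst ha
      refine ne_none_of_mem_sdiStep ?_ (foldl_sdiStep_subset _ _ _ hμ)
      obtain ⟨ν, hν⟩ := hne
      cases hc : ν a with
      | some h =>
        exact ⟨ν, hν, by rw [hc]; exact (one_lt_urank_some_iff _ _ _ _).2 (hacc h)⟩
      | none =>
        obtain ⟨h, hh⟩ : ∃ h, ∀ c', ν c' ≠ some h := by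
          by_contra! hcon
          choose f hf using hcon
          have hinj : f.Injective := fun x y hxy => by
            have := (hf x).symm.trans (hxy ▸ hf y)
            simpa using this
          have hsurj := ((Fintype.bijective_iff_injective_and_card f).2 ⟨hinj, hcard⟩).2
          obtain ⟨x, hx⟩ := hsurj a
          have := hf x
          rw [hx, hc] at this
          cases this
        exact ⟨_, hclosed ν hν hc h hh, by
          rw [Function.update_self]; exact (one_lt_urank_some_iff _ _ _ _).2 (hacc h)⟩
    · exact ih ((List.mem_cons.1 hl).resolve_left (Ne.symm ha)) _ (sdiStep_nonempty a hne)
        ((sdiStep_subset _ _ _).trans hU) (hclosed.sdiStep ha) hμ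

lemma none_notMem_SDIConsistentOut [Fintype C] [Fintype H]
    (hcard : Fintype.card H = Fintype.card C) {c : C} {p e : OptRel H}
    (hacc : ∀ h, p (some h) none ∧ e (some h) none) : none ∉ SDIConsistentOut c p e := by
  rintro ⟨pref, eval, order, μ, -, -, rfl, rfl, horder, hμ, hc⟩
  refine ne_none_of_mem_foldl_sdiStep hcard hacc order (horder c) _
    ⟨_, sdiFinal_subset _ _ hμ⟩ subset_rfl ?_ hμ hc
  intro ν hν hνc h hh
  have hval : ∀ a k, Function.update ν c (some h) a = some k →
      (a = c ∧ k = h) ∨ (a ≠ c ∧ ν a = some k) := by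
    intro a k hak
    by_cases ha : a = c
    · subst ha
      rw [Function.update_self, Option.some.injEq] at hak
      exact Or.inl ⟨rfl, hak.symm⟩
    · rw [Function.update_of_ne ha] at hak
      exact Or.inr ⟨ha, hak⟩
  refine ⟨?_, indivRat_of_acceptable ?_⟩
  · intro a b k ha hb
    rcases hval a k ha with ⟨hac, hk⟩ | ⟨-, ha⟩ <;> rcases hval b k hb with ⟨hbc, hk'⟩ | ⟨-, hb⟩
    · exact hac.trans hbc.symm
    · exact absurd (hk ▸ hb) (hh b)
    · exact absurd (hk' ▸ ha) (hh a)
    · exact hν.1 a b k ha hb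
  · intro a k ha
    rcases hval a k ha with ⟨rfl, rfl⟩ | ⟨-, ha⟩
    · exact hacc k
    · exact hν.2.unanAcc ha

/-- **SDI is non-obviously manipulable when `|H| ≤ |C|`.**
No child has a worst-case manipulation or a best-case manipulation of Serial
Dictatorship with Indifference applied to the unanimous rankings. -/
theorem sdi_non_obviously_manipulable {C H : Type*} [Fintype C] [Fintype H]
    (hcard : Fintype.card H ≤ Fintype.card C)
    (c : C) (p e p' : OptRel H)
    (hp : IsStrictTotalOrder (Option H) p) (he : IsStrictTotalOrder (Option H) e)
    (hp' : IsStrictTotalOrder (Option H) p') :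
    (∀ w' w : Option H,
      IsWorst p (SDIConsistentOut (C := C) c p' e) w' →
      IsWorst p (SDIConsistentOut (C := C) c p e) w → ¬ p w' w) ∧
    (∀ b' b : Option H,
      IsBest p (SDIConsistentOut (C := C) c p' e) b' →
      IsBest p (SDIConsistentOut (C := C) c p e) b → ¬ p b' b) := by
  have hasymm : ∀ a b, p a b → ¬ p b a := fun a b h h' => hp.irrefl a (hp.trans _ _ _ h h')
  have hworst : ∀ {S : Set (Option H)} {w y : Option H}, IsWorst p S w → y ∈ S → ¬ p w y := by
    intro S w y hw hy h
    rcases hw.2 y hy with rfl | h'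
    · exact hp.irrefl _ h
    · exact hasymm _ _ h h'
  have hnone : ∀ {y : Option H}, y ∈ SDIConsistentOut (C := C) c p e → ¬ p none y := by
    intro y hy h
    cases y with
    | none => exact hp.irrefl _ h
    | some x => exact hasymm _ _ h (acceptable_of_some_mem_SDIConsistentOut hy).1
  constructor
  · intro w' w hw' hw hlt
    have hno : ∀ y ∈ SDIConsistentOut (C := C) c p' e, (y = w ∨ p w y) → False := by
      rintro y hy (rfl | h)
      · exact hworst hw' hy hlt
      · exact hworst hw' hy (hp.trans _ _ _ hlt h)
    have hge : none = w ∨ p w none := by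
      cases w with
      | none => exact Or.inl rfl
      | some x => exact Or.inr (acceptable_of_some_mem_SDIConsistentOut hw.1).1
    have hnone' : none ∉ SDIConsistentOut (C := C) c p' e := fun h => hno _ h hge
    have hcard' : Fintype.card H = Fintype.card C := by
      by_contra hne
      exact hnone' (none_mem_SDIConsistentOut_of_card_lt (lt_of_le_of_ne hcard hne) hp' he)
    have hacc' : ∀ h, p' (some h) none ∧ e (some h) none := fun h => by
      by_contra hcon
      exact hnone' (none_mem_SDIConsistentOut_of_not_acceptable hcard hp' he hcon)
    have hmem' : ∀ h, some h ∈ SDIConsistentOut (C := C) c p' e := fun h =>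
      some_mem_SDIConsistentOut hcard hp' he (hacc' h).1 (hacc' h).2
    cases w with
    | some x => exact hno _ (hmem' x) (Or.inl rfl)
    | none =>
      have hacc : ∀ h, p (some h) none ∧ e (some h) none := by
        intro h
        refine ⟨?_, (hacc' h).2⟩
        by_contra hcon
        refine hno _ (hmem' h) (Or.inr ?_)
        by_contra hcon'
        exact Option.some_ne_none h (hp.trichotomous _ _ hcon hcon')
      exact none_notMem_SDIConsistentOut hcard' hacc hw.1
  · intro b' b hb' hb hlt
    cases b' with
    | none => exact hnone hb.1 hlt
    | some x =>
      have hpx : p (some x) none := by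
        cases b with
        | none => exact hlt
        | some y => exact hp.trans _ _ _ hlt (acceptable_of_some_mem_SDIConsistentOut hb.1).1
      have hx := some_mem_SDIConsistentOut (c := c) hcard hp he hpx
        (acceptable_of_some_mem_SDIConsistentOut hb'.1).2
      rcases hb.2 _ hx with h | h
      · exact hp.irrefl _ (h ▸ hlt)
      · exact hasymm _ _ hlt h

end
end

section
/- If a matching μ is constrained-efficient and unanimous, then μ is efficient with respect to the extended unanimity orders (T^u_c)_{c∈C}: there is no matching μ' such that for every child c either μ'(c) = μ(c) or μ'(c) T^u_c μ(c), with μ'(c') T^u_{c'} μ(c') for at least one child c'. -/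
open scoped Classical

noncomputable section

variable {C H : Type*}

/-- A home lies in `H*(c)` or in `H^-(c)` exactly when it is unanimously acceptable. -/
theorem mem_Hstar_or_mem_Hminus_iff (pref eval : C → OptRel H) (c : C) (h : H) :
    (h ∈ Hstar pref eval c ∨ h ∈ Hminus pref eval c) ↔ UnanAcc pref eval c h := by
  simp only [Hstar, Hminus, Set.mem_ofPred_eq]
  tauto

/-- A child belongs to `κ(μ)` exactly when she is matched to an acceptable home. -/
theorem mem_kappaSet_iff (pref eval : C → OptRel H) (μ : C → Option H) (c : C) :
    c ∈ kappaSet pref eval μ ↔ ∃ h, μ c = some h ∧ UnanAcc pref eval c h := by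
  simp only [kappaSet, Set.mem_ofPred_eq, mem_Hstar_or_mem_Hminus_iff]

/-- Whatever is `T^u_c`-above an acceptable assignment is an acceptable home, and it lies in
`H*(c)` if the original assignment does. -/
theorem Tu.exists_unanAcc {pref eval : C → OptRel H} {c : C} {x y : Option H}
    (hxy : Tu pref eval c x y) (hy : ∀ h, y = some h → UnanAcc pref eval c h) :
    ∃ h, x = some h ∧ UnanAcc pref eval c h ∧
      ∀ h', y = some h' → h' ∈ Hstar pref eval c → h ∈ Hstar pref eval c := by
  cases x with
  | none =>
    cases y with
    | none => exact hxy.elim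
    | some h' => exact (hxy (hy h' rfl)).elim
  | some h =>
    refine ⟨h, rfl, ?_⟩
    cases y with
    | none => exact ⟨hxy, by simp⟩
    | some h' =>
      have acc := hy h' rfl
      simp only [Tu, Set.mem_union, mem_Hstar_or_mem_Hminus_iff] at hxy
      simp only [Option.some.injEq, forall_eq']
      have hs := mem_Hstar_or_mem_Hminus_iff pref eval c h
      have hm : h' ∈ Hminus pref eval c → h' ∉ Hstar pref eval c := fun k => k.2
      tauto

/-- Between homes that are both acceptable and agree on membership in `H*(c)`, the relation
`T^u_c` is the preference of `c`. -/
theorem Tu.pref_of_mem_Hstar {pref eval : C → OptRel H} {c : C} {h h' : H}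
    (hT : Tu pref eval c (some h) (some h')) (acc : UnanAcc pref eval c h')
    (hstar : h ∈ Hstar pref eval c → h' ∈ Hstar pref eval c) :
    pref c (some h) (some h') := by
  simp only [Tu, Set.mem_union, mem_Hstar_or_mem_Hminus_iff] at hT
  tauto

/-- **constrained-efficient and unanimous ⟹ efficient under `T^u`.**
If `μ` is unanimous and constrained-efficient, then no matching Pareto dominates `μ`
with respect to the extended unanimity orders `(T^u_c)`. -/
theorem constrained_efficient_unanimous_implies_tu_efficient {C H : Type*}
    (pref eval : C → OptRel H)
    (hpref : ∀ c, IsStrictTotalOrder (Option H) (pref c))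
    (heval : ∀ c, IsStrictTotalOrder (Option H) (eval c))
    (μ : C → Option H) (hunan : Unanimous pref eval μ)
    (hce : ¬ ∃ μ' : C → Option H, IsMatching μ' ∧ ParetoDom pref μ μ' ∧
        Istar pref eval μ ⊆ Istar pref eval μ' ∧
        kappaSet pref eval μ ⊆ kappaSet pref eval μ') :
    ¬ ∃ μ' : C → Option H, IsMatching μ' ∧
        (∀ c, μ' c = μ c ∨ Tu pref eval c (μ' c) (μ c)) ∧
        (∃ c, Tu pref eval c (μ' c) (μ c)) := by
  obtain ⟨-, hacc, hmax⟩ := hunan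
  rintro ⟨ν, hν, hweak, d, hd⟩
  have hνacc : Acceptable pref eval ν := by
    intro c h hc
    rcases hweak c with heq | hT
    · exact hacc c h (heq ▸ hc)
    · obtain ⟨k, hk, hkacc, -⟩ := hT.exists_unanAcc (hacc c)
      obtain rfl : k = h := Option.some.inj (hk.symm.trans hc)
      exact hkacc
  have hI : Istar pref eval μ ⊆ Istar pref eval ν := by
    rintro c ⟨h, hc, hstar⟩
    rcases hweak c with heq | hT
    · exact ⟨h, heq.trans hc, hstar⟩
    · obtain ⟨k, hk, -, hkstar⟩ := hT.exists_unanAcc (hacc c)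
      exact ⟨k, hk, hkstar h hc hstar⟩
  have hκ : kappaSet pref eval μ ⊆ kappaSet pref eval ν := by
    intro c hcμ
    rw [mem_kappaSet_iff] at hcμ ⊢
    obtain ⟨h, hc, hh⟩ := hcμ
    rcases hweak c with heq | hT
    · exact ⟨h, heq.trans hc, hh⟩
    · obtain ⟨k, hk, hkacc, -⟩ := hT.exists_unanAcc (hacc c)
      exact ⟨k, hk, hkacc⟩
  have hI' : Istar pref eval ν ⊆ Istar pref eval μ := by
    by_contra hne
    exact hmax ν hν hνacc (Or.inl ⟨⟨hI, hne⟩, hκ⟩)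
  have hκ' : kappaSet pref eval ν ⊆ kappaSet pref eval μ := by
    by_contra hne
    exact hmax ν hν hνacc (Or.inr ⟨hI, hκ, hne⟩)
  have hTpref : ∀ c, Tu pref eval c (ν c) (μ c) → pref c (ν c) (μ c) := by
    intro c hT
    obtain ⟨k, hk, hkacc, -⟩ := hT.exists_unanAcc (hacc c)
    obtain ⟨h, hc, hh⟩ := (mem_kappaSet_iff pref eval μ c).1
      (hκ' ((mem_kappaSet_iff pref eval ν c).2 ⟨k, hk, hkacc⟩))
    rw [hk, hc] at hT ⊢
    refine hT.pref_of_mem_Hstar hh fun hkstar => ?_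
    obtain ⟨h₁, hc₁, hh₁⟩ := hI' ⟨k, hk, hkstar⟩
    obtain rfl : h₁ = h := Option.some.inj (hc₁.symm.trans hc)
    exact hh₁
  exact hce ⟨ν, hν, ⟨fun c => (hweak c).imp_right (hTpref c), d, hTpref d hd⟩, hI, hκ⟩

end
end
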